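/- arXiv:1312.5192 — 2 statements merged into one kernel-verified Lean document; each statement's English description precedes it below -/
import Mathlib

section
/- Let (V,w) be a finite undirected weighted graph with cut function R̂(C) := cut(C, C̄) and R := TV its Lovasz extension. Let Ŝ be a nonnegative symmetric set function with Ŝ(∅) = 0 and Ŝ(C) > 0 for every ∅ ≠ C ⊊ V, let S be its Lovasz extension, and write S = S₁ − S₂ where S₁, S₂ are Lovasz extensions of submodular set functions Ŝ₁, Ŝ₂ vanishing on ∅ and V. Let f* ∈ ℝ^V with G(f*) = 1 and S(f*) ≠ 0, and suppose there exists s₁ ∈ ∂S₁(f*) such that f* minimizes Φ⁰_{f*}(u) := TV(u) + F(f*)·(S₂(u) − ⟨u, s₁⟩) over {u : G(u) ≤ 1}, where F(f*) := TV(f*)/S(f*). Then: (a) the minimum over t ∈ ℝ with ∅ ≠ C_t ⊊ V of cut(C_t, C̄_t)/Ŝ(C_t), where C_t := {i : f*_i > t}, equals F(f*); and (b) every upper level set C of f* (i.e., C = {j : f*_j > f*_i} for some i) with ∅ ≠ C ⊊ V satisfies cut(C, C̄)/Ŝ(C) = F(f*). -/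
open Finset Filter

/-- Euclidean inner product on `V → ℝ`. -/
def ip {V : Type*} [Fintype V] (f g : V → ℝ) : ℝ := ∑ i, f i * g i

/-- Euclidean norm on `V → ℝ`. -/
noncomputable def nrm {V : Type*} [Fintype V] (f : V → ℝ) : ℝ :=
  Real.sqrt (∑ i, (f i) ^ 2)

/-- The subdifferential of `A` at `f`:  `a ∈ subdiff A f` iff
`A u ≥ A f + ⟨a, u - f⟩` for all `u`. -/
def subdiff {V : Type*} [Fintype V] (A : (V → ℝ) → ℝ) (f : V → ℝ) : Set (V → ℝ) :=
  {a | ∀ u, A f + ip a (u - f) ≤ A u}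

/-- Positively one-homogeneous. -/
def PosOneHom {V : Type*} (A : (V → ℝ) → ℝ) : Prop :=
  ∀ ν : ℝ, 0 ≤ ν → ∀ f, A (ν • f) = ν * A f

/-- Positively `p`-homogeneous (real exponent, via `rpow`). -/
noncomputable def PosPHom {V : Type*} (p : ℝ) (A : (V → ℝ) → ℝ) : Prop :=
  ∀ ν : ℝ, 0 ≤ ν → ∀ f, A (ν • f) = ν ^ p * A f

/-- The inner objective `Φ_f^c` of RatioDCA-prox, with `F f = (R₁ f - R₂ f)/(S₁ f - S₂ f)`. -/
noncomputable def Phi {V : Type*} [Fintype V] (R1 R2 S1 S2 : (V → ℝ) → ℝ)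
    (f r2 s1 g : V → ℝ) (c : ℝ) (u : V → ℝ) : ℝ :=
  R1 u - ip u r2 + ((R1 f - R2 f) / (S1 f - S2 f)) * (S2 u - ip u s1) - c * ip u g

/-- The cut value of a set `A` in the weighted graph `w`. -/
def cutF {n : ℕ} (w : Fin n → Fin n → ℝ) (A : Finset (Fin n)) : ℝ :=
  ∑ i ∈ A, ∑ j ∈ Aᶜ, w i j

/-- The graph total variation `TV f = (1/2) ∑_{i,j} w_{ij} |f_i - f_j|`. -/
noncomputable def tv {n : ℕ} (w : Fin n → Fin n → ℝ) (f : Fin n → ℝ) : ℝ :=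
  (1 / 2) * ∑ i, ∑ j, w i j * |f i - f j|

/-- The indicator vector of a set `A ⊆ V`. -/
def indic {n : ℕ} (A : Finset (Fin n)) : Fin n → ℝ := fun i => if i ∈ A then 1 else 0

/-- The Lovasz extension of a set function `Ŝ` with `Ŝ ∅ = 0`:
`S f = ∑_{i=1}^n f_i (Ŝ(C_{i-1}) - Ŝ(C_i))` where the values of `f` are sorted increasingly
and `C_i` consists of the elements at sorted positions `> i`. -/
noncomputable def lovasz {n : ℕ} (Shat : Finset (Fin n) → ℝ) (f : Fin n → ℝ) : ℝ :=
  ∑ k : Fin n, f (Tuple.sort f k) *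
    (Shat (Finset.univ.filter fun j => (k : ℕ) ≤ ((Tuple.sort f).symm j : ℕ)) -
     Shat (Finset.univ.filter fun j => (k : ℕ) + 1 ≤ ((Tuple.sort f).symm j : ℕ)))

lemma lovasz_telescope {n : ℕ} (S : Finset (Fin n) → ℝ) (h0 : S ∅ = 0)
    (σ : Equiv.Perm (Fin n)) (C : Finset (Fin n)) (hm : Monotone (indic C ∘ σ)) :
    ∑ k : Fin n, indic C (σ k) *
      (S (Finset.univ.filter fun j => (k : ℕ) ≤ (σ.symm j : ℕ)) -
       S (Finset.univ.filter fun j => (k : ℕ) + 1 ≤ (σ.symm j : ℕ))) = S C := by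
  classical
  have hex : ∃ m : ℕ, ∀ k : Fin n, m ≤ (k : ℕ) → σ k ∈ C :=
    ⟨n, fun k hk => absurd k.2 (by omega)⟩
  obtain ⟨m, hmn, hmC⟩ : ∃ m : ℕ, m ≤ n ∧ ∀ k : Fin n, σ k ∈ C ↔ m ≤ (k : ℕ) := by
    refine ⟨Nat.find hex, Nat.find_min' hex (fun k hk => absurd k.2 (by omega)), fun k => ?_⟩
    refine ⟨fun hk => ?_, fun hk => Nat.find_spec hex k hk⟩
    refine Nat.find_min' hex (fun l hl => ?_)
    have h1 := hm (show k ≤ l from hl)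
    by_contra hcon
    simp only [Function.comp, indic, hk, hcon, if_true, if_false] at h1
    linarith
  set h : ℕ → ℝ := fun k => S (Finset.univ.filter fun j => k ≤ (σ.symm j : ℕ)) with hh
  have hn : h n = 0 := by
    have : (Finset.univ.filter fun j => n ≤ (σ.symm j : ℕ)) = ∅ := by
      ext j
      have := (σ.symm j).2
      simp
    simp only [hh, this, h0]
  have hmS : h m = S C := by
    have : (Finset.univ.filter fun j => m ≤ (σ.symm j : ℕ)) = C := by
      ext j
      simp [← hmC]
    simp only [hh, this]
  have h1 : ∀ k : Fin n, indic C (σ k) *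
      (S (Finset.univ.filter fun j => (k : ℕ) ≤ (σ.symm j : ℕ)) -
       S (Finset.univ.filter fun j => (k : ℕ) + 1 ≤ (σ.symm j : ℕ))) =
      (fun k : ℕ => if m ≤ k then h k - h (k + 1) else 0) (k : ℕ) := by
    intro k
    by_cases hk : m ≤ (k : ℕ)
    · have := (hmC k).2 hk
      simp [indic, this, hk, hh]
    · have h2 : ¬ σ k ∈ C := fun hc => hk ((hmC k).1 hc)
      simp [indic, h2, hk]
  rw [Finset.sum_congr rfl (fun k _ => h1 k),
    Fin.sum_univ_eq_sum_range (fun k : ℕ => if m ≤ k then h k - h (k + 1) else 0) n]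
  have h2 : ∀ N : ℕ, ∑ k ∈ Finset.range N, (if m ≤ k then h k - h (k + 1) else 0) =
      if m ≤ N then h m - h N else 0 := by
    intro N
    induction N with
    | zero =>
      by_cases hm0 : m = 0
      · simp [hm0]
      · simp [hm0]
    | succ N ih =>
      rw [Finset.sum_range_succ, ih]
      by_cases h3 : m ≤ N
      · rw [if_pos h3, if_pos h3, if_pos (by omega)]; ring
      · rw [if_neg h3, if_neg h3]
        by_cases h4 : m = N + 1
        · simp [h4]
        · rw [if_neg (by omega)]; ring
  rw [h2, if_pos hmn, hn, hmS, sub_zero]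

lemma lovasz_indic {n : ℕ} (S : Finset (Fin n) → ℝ) (h0 : S ∅ = 0) (C : Finset (Fin n)) :
    lovasz S (indic C) = S C :=
  lovasz_telescope S h0 _ C (Tuple.monotone_sort _)

lemma sort_congr {n : ℕ} (f g : Fin n → ℝ) (h : ∀ i j, f i ≤ f j ↔ g i ≤ g j) :
    Tuple.sort f = Tuple.sort g := by
  obtain ⟨h1, h2⟩ := (Tuple.eq_sort_iff (f := f)).1 rfl
  refine Tuple.eq_sort_iff.2 ⟨fun a b hab => (h _ _).1 (h1 hab), fun a b hab he => ?_⟩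
  exact h2 a b hab (le_antisymm ((h _ _).2 he.le) ((h _ _).2 he.ge))

lemma lovasz_smul {n : ℕ} (S : Finset (Fin n) → ℝ) (c : ℝ) (hc : 0 < c) (f : Fin n → ℝ) :
    lovasz S (c • f) = c * lovasz S f := by
  have : Tuple.sort (c • f) = Tuple.sort f :=
    sort_congr _ _ (fun i j => by simp [hc])
  unfold lovasz
  rw [this, Finset.mul_sum]
  refine Finset.sum_congr rfl (fun k _ => ?_)
  simp only [Pi.smul_apply, smul_eq_mul]
  ring

lemma lovasz_const {n : ℕ} (S : Finset (Fin n) → ℝ) (h0 : S ∅ = 0)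
    (f : Fin n → ℝ) (c : ℝ) (hf : ∀ i, f i = c) :
    lovasz S f = c * S Finset.univ := by
  have := lovasz_telescope S h0 (Tuple.sort f) Finset.univ
    (fun a b _ => by simp [indic])
  rw [← this, Finset.mul_sum]
  unfold lovasz
  refine Finset.sum_congr rfl (fun k _ => ?_)
  simp [indic, hf]

lemma lovasz_add_indic {n : ℕ} (S : Finset (Fin n) → ℝ) (h0 : S ∅ = 0)
    (f g : Fin n → ℝ) (C : Finset (Fin n)) (e : ℝ) (hfg : f = g + e • indic C)
    (hord : ∀ i j, f i ≤ f j ↔ g i ≤ g j)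
    (hC : ∀ i j, f i ≤ f j → indic C i ≤ indic C j) :
    lovasz S f = lovasz S g + e * S C := by
  have hs := sort_congr f g hord
  have ht := lovasz_telescope S h0 (Tuple.sort f) C
    (fun a b hab => hC _ _ (Tuple.monotone_sort f hab))
  rw [← ht, Finset.mul_sum]
  unfold lovasz
  rw [← hs, ← Finset.sum_add_distrib]
  refine Finset.sum_congr rfl (fun k _ => ?_)
  have : f (Tuple.sort f k) = g (Tuple.sort f k) + e * indic C (Tuple.sort f k) := by
    conv_lhs => rw [hfg]
    simp [← hfg]
  rw [this]; ring

lemma tv_smul {n : ℕ} (w : Fin n → Fin n → ℝ) (c : ℝ) (hc : 0 < c) (f : Fin n → ℝ) :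
    tv w (c • f) = c * tv w f := by
  unfold tv
  rw [mul_left_comm c, Finset.mul_sum Finset.univ _ c]
  congr 1
  refine Finset.sum_congr rfl (fun i _ => ?_)
  rw [Finset.mul_sum]
  refine Finset.sum_congr rfl (fun j _ => ?_)
  simp only [Pi.smul_apply, smul_eq_mul]
  rw [← mul_sub, abs_mul, abs_of_pos hc]; ring

lemma tv_indic {n : ℕ} (w : Fin n → Fin n → ℝ) (hw : ∀ i j, w i j = w j i)
    (C : Finset (Fin n)) : tv w (indic C) = cutF w C := by
  classical
  have h1 : cutF w C = ∑ i, ∑ j, if i ∈ C ∧ j ∉ C then w i j else 0 := by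
    unfold cutF
    rw [← Finset.sum_filter_add_sum_filter_not Finset.univ (fun i => i ∈ C)
      (fun i => ∑ j, if i ∈ C ∧ j ∉ C then w i j else (0 : ℝ))]
    have : ∑ i ∈ Finset.univ.filter (fun i => ¬ i ∈ C),
        (∑ j, if i ∈ C ∧ j ∉ C then w i j else 0) = 0 := by
      refine Finset.sum_eq_zero (fun i hi => Finset.sum_eq_zero (fun j _ => ?_))
      simp at hi
      simp [hi]
    rw [this, add_zero]
    have h3 : Finset.univ.filter (fun i => i ∈ C) = C := by ext; simp
    rw [h3]
    refine Finset.sum_congr rfl (fun i hi => ?_)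
    have h4 : Cᶜ = Finset.univ.filter (fun i => i ∉ C) := by ext; simp
    rw [h4, Finset.sum_filter]
    simp [hi]
  have h2 : cutF w C = ∑ i, ∑ j, if j ∈ C ∧ i ∉ C then w i j else 0 := by
    rw [h1, Finset.sum_comm]
    refine Finset.sum_congr rfl (fun i _ => Finset.sum_congr rfl (fun j _ => ?_))
    rw [hw]
  have h3 : ∑ i, ∑ j, w i j * |indic C i - indic C j| = cutF w C + cutF w C := by
    nth_rewrite 1 [h1]
    rw [h2, ← Finset.sum_add_distrib]
    refine Finset.sum_congr rfl (fun i _ => ?_)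
    rw [← Finset.sum_add_distrib]
    refine Finset.sum_congr rfl (fun j _ => ?_)
    by_cases hi : i ∈ C <;> by_cases hj : j ∈ C <;> simp [indic, hi, hj]
  unfold tv
  rw [h3]; ring

lemma tv_add_indic {n : ℕ} (w : Fin n → Fin n → ℝ) (hw : ∀ i j, w i j = w j i)
    (f g : Fin n → ℝ) (C : Finset (Fin n)) (e : ℝ) (he : 0 < e) (hfg : f = g + e • indic C)
    (hord : ∀ i j, f i ≤ f j ↔ g i ≤ g j)
    (hC : ∀ i j, f i ≤ f j → indic C i ≤ indic C j) :
    tv w f = tv w g + e * cutF w C := by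
  rw [← tv_indic w hw]
  unfold tv
  rw [mul_left_comm e, ← mul_add, Finset.mul_sum Finset.univ _ e, ← Finset.sum_add_distrib]
  congr 1
  refine Finset.sum_congr rfl (fun i _ => ?_)
  rw [Finset.mul_sum, ← Finset.sum_add_distrib]
  refine Finset.sum_congr rfl (fun j _ => ?_)
  have hv : ∀ i, f i = g i + e * indic C i := fun i => by
    rw [hfg]; simp
  have key : |f i - f j| = |g i - g j| + e * |indic C i - indic C j| := by
    rcases le_total (f i) (f j) with h | h
    · have a := (hord _ _).1 h
      have b := hC _ _ h
      rw [abs_of_nonpos (by linarith), abs_of_nonpos (by linarith),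
        abs_of_nonpos (by linarith), hv i, hv j]; ring
    · have a := (hord _ _).1 h
      have b := hC _ _ h
      rw [abs_of_nonneg (by linarith), abs_of_nonneg (by linarith),
        abs_of_nonneg (by linarith), hv i, hv j]; ring
  rw [key]; ring

lemma ip_add_smul {n : ℕ} (g h s : Fin n → ℝ) (e : ℝ) :
    ip (g + e • h) s = ip g s + e * ip h s := by
  unfold ip
  rw [Finset.mul_sum, ← Finset.sum_add_distrib]
  refine Finset.sum_congr rfl (fun k _ => ?_)
  simp; ring

lemma ip_smul' {n : ℕ} (g s : Fin n → ℝ) (e : ℝ) :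
    ip (e • g) s = e * ip g s := by
  unfold ip
  rw [Finset.mul_sum]
  refine Finset.sum_congr rfl (fun k _ => ?_)
  simp; ring

lemma ip_sub' {n : ℕ} (a b s : Fin n → ℝ) : ip s (a - b) = ip a s - ip b s := by
  unfold ip
  rw [← Finset.sum_sub_distrib]
  refine Finset.sum_congr rfl (fun k _ => ?_)
  simp; ring

/-- characterization of accumulation points of RatioDCA-prox (with `c^k = 0`)
for balanced graph cuts with Lovasz-extension balancing function: optimal thresholding of
`f*` attains `F(f*)`, and every proper nonempty upper level set of `f*` realizes the
ratio `F(f*)`. -/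
theorem ratioDCA_prox_accumulation_balanced_cut {n : ℕ} (w : Fin n → Fin n → ℝ)
    (hwsym : ∀ i j, w i j = w j i) (hwnonneg : ∀ i j, 0 ≤ w i j)
    (p : ℝ) (hp : 1 ≤ p)
    (Shat1 Shat2 Shat : Finset (Fin n) → ℝ)
    (hsub1 : ∀ A B : Finset (Fin n), Shat1 (A ∪ B) + Shat1 (A ∩ B) ≤ Shat1 A + Shat1 B)
    (hsub2 : ∀ A B : Finset (Fin n), Shat2 (A ∪ B) + Shat2 (A ∩ B) ≤ Shat2 A + Shat2 B)
    (hempty1 : Shat1 ∅ = 0) (huniv1 : Shat1 Finset.univ = 0)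
    (hempty2 : Shat2 ∅ = 0) (huniv2 : Shat2 Finset.univ = 0)
    (hShat : ∀ A, Shat A = Shat1 A - Shat2 A)
    (hnonneg : ∀ A, 0 ≤ Shat A) (hsym : ∀ A : Finset (Fin n), Shat Aᶜ = Shat A)
    (hShatpos : ∀ C : Finset (Fin n), C.Nonempty → C ≠ Finset.univ → 0 < Shat C)
    (G : (Fin n → ℝ) → ℝ)
    (hGconv : ConvexOn ℝ Set.univ G) (hGnonneg : ∀ u, 0 ≤ G u)
    (hGhom : PosPHom p G) (hGzero : ∀ u, G u = 0 ↔ u = 0)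
    (fstar : Fin n → ℝ) (hGfs : G fstar = 1)
    (hSfs : lovasz Shat1 fstar - lovasz Shat2 fstar ≠ 0)
    (s1 : Fin n → ℝ) (hs1 : s1 ∈ subdiff (lovasz Shat1) fstar)
    (hmin : ∀ u, G u ≤ 1 →
      tv w fstar + tv w fstar / (lovasz Shat1 fstar - lovasz Shat2 fstar) *
          (lovasz Shat2 fstar - ip fstar s1) ≤
        tv w u + tv w fstar / (lovasz Shat1 fstar - lovasz Shat2 fstar) *
          (lovasz Shat2 u - ip u s1)) :
    IsLeast {r : ℝ | ∃ t : ℝ,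
        (Finset.univ.filter fun i => t < fstar i).Nonempty ∧
        (Finset.univ.filter fun i => t < fstar i) ≠ Finset.univ ∧
        r = cutF w (Finset.univ.filter fun i => t < fstar i) /
              Shat (Finset.univ.filter fun i => t < fstar i)}
      (tv w fstar / (lovasz Shat1 fstar - lovasz Shat2 fstar)) ∧
    ∀ i : Fin n,
      (Finset.univ.filter fun j => fstar i < fstar j).Nonempty →
      (Finset.univ.filter fun j => fstar i < fstar j) ≠ Finset.univ →
      cutF w (Finset.univ.filter fun j => fstar i < fstar j) /
          Shat (Finset.univ.filter fun j => fstar i < fstar j) =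
        tv w fstar / (lovasz Shat1 fstar - lovasz Shat2 fstar) := by
  classical
  set lam := tv w fstar / (lovasz Shat1 fstar - lovasz Shat2 fstar) with hlam
  have hsub : ∀ u, lovasz Shat1 fstar + (ip u s1 - ip fstar s1) ≤ lovasz Shat1 u := by
    intro u
    have := hs1 u
    rwa [ip_sub'] at this
  -- Euler identity for the subgradient
  have heul : ip fstar s1 = lovasz Shat1 fstar := by
    have a := hsub ((2 : ℝ) • fstar)
    have b := hsub ((1 / 2 : ℝ) • fstar)
    rw [lovasz_smul _ _ (by norm_num), ip_smul'] at a b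
    linarith
  have hle : ∀ u, ip u s1 ≤ lovasz Shat1 u := fun u => by
    have := hsub u
    linarith
  have hlamS : tv w fstar = lam * (lovasz Shat1 fstar - lovasz Shat2 fstar) := by
    rw [hlam, div_mul_cancel₀ _ hSfs]
  have hpsi : ∀ u, 0 ≤ tv w u + lam * (lovasz Shat2 u - ip u s1) := by
    intro u
    have hG := hGnonneg u
    have hc : (0 : ℝ) < 1 / (1 + G u) := by positivity
    have hc1 : 1 / (1 + G u) ≤ 1 := by
      rw [div_le_one (by positivity)]; linarith
    set c := 1 / (1 + G u) with hcdef
    have hGc : G (c • u) ≤ 1 := by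
      rw [hGhom c hc.le]
      have h1 : c ^ p ≤ c := by
        have := Real.rpow_le_rpow_of_exponent_ge hc hc1 hp
        rwa [Real.rpow_one] at this
      have h2 : c * (1 + G u) = 1 := by
        rw [hcdef]; field_simp
      nlinarith
    have := hmin (c • u) hGc
    rw [tv_smul _ _ hc, lovasz_smul _ _ hc, ip_smul', heul] at this
    have h3 : 0 ≤ c * (tv w u + lam * (lovasz Shat2 u - ip u s1)) := by
      nlinarith
    exact nonneg_of_mul_nonneg_right h3 hc
  have main : ∀ i : Fin n,
      (Finset.univ.filter fun j => fstar i < fstar j).Nonempty →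
      (Finset.univ.filter fun j => fstar i < fstar j) ≠ Finset.univ →
      cutF w (Finset.univ.filter fun j => fstar i < fstar j) /
          Shat (Finset.univ.filter fun j => fstar i < fstar j) = lam := by
    intro i hne hnu
    have hpos := hShatpos _ hne hnu
    have hmem : ∀ j, j ∈ (Finset.univ.filter fun j => fstar i < fstar j) ↔ fstar i < fstar j :=
      fun j => by simp
    obtain ⟨m, hmC, hmmin⟩ := Finset.exists_min_image _ fstar hne
    generalize (Finset.univ.filter fun j => fstar i < fstar j) = C at *
    have hmi := (hmem m).1 hmC
    set e := (fstar m - fstar i) / 2 with he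
    have hepos : 0 < e := by rw [he]; linarith
    set g : Fin n → ℝ := fstar - e • indic C with hg
    have hfg : fstar = g + e • indic C := by rw [hg]; simp
    have hgv : ∀ a, g a = fstar a - e * indic C a := fun a => by rw [hg]; simp
    have hC : ∀ a b, fstar a ≤ fstar b → indic C a ≤ indic C b := by
      intro a b hab
      by_cases ha : a ∈ C
      · have hb : b ∈ C := (hmem b).2 (lt_of_lt_of_le ((hmem a).1 ha) hab)
        simp [indic, ha, hb]
      · by_cases hb : b ∈ C <;> simp [indic, ha, hb]
    have hord : ∀ a b, fstar a ≤ fstar b ↔ g a ≤ g b := by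
      intro a b
      rw [hgv, hgv]
      by_cases ha : a ∈ C <;> by_cases hb : b ∈ C
      · simp [indic, ha, hb]
      · have h1 := hmmin a ha
        have h2 : fstar b ≤ fstar i := not_lt.1 (fun h => hb ((hmem b).2 h))
        simp only [indic, ha, hb, if_true, if_false]
        constructor <;> intro h <;> linarith
      · have h1 := hmmin b hb
        have h2 : fstar a ≤ fstar i := not_lt.1 (fun h => ha ((hmem a).2 h))
        simp only [indic, ha, hb, if_true, if_false]
        constructor <;> intro h <;> linarith
      · simp [indic, ha, hb]
    have e1 := lovasz_add_indic Shat1 hempty1 fstar g C e hfg hord hC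
    have e2 := lovasz_add_indic Shat2 hempty2 fstar g C e hfg hord hC
    have e3 := tv_add_indic w hwsym fstar g C e hepos hfg hord hC
    have e4 : ip fstar s1 = ip g s1 + e * ip (indic C) s1 := by
      conv_lhs => rw [hfg]
      exact ip_add_smul _ _ _ _
    have l1 := hle g
    have l2 := hle (indic C)
    rw [lovasz_indic _ hempty1] at l2
    have l3 : e * ip (indic C) s1 = e * Shat1 C := by
      have := mul_le_mul_of_nonneg_left l2 hepos.le
      linarith
    have l4 : ip (indic C) s1 = Shat1 C := mul_left_cancel₀ hepos.ne' l3
    have l5 : ip g s1 = lovasz Shat1 g := by linarith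
    have p1 := hpsi g
    have p2 := hpsi (indic C)
    rw [lovasz_indic _ hempty2, tv_indic w hwsym, l4] at p2
    rw [l5] at p1
    have p3 : (tv w g + lam * (lovasz Shat2 g - lovasz Shat1 g)) +
        e * (cutF w C + lam * (Shat2 C - Shat1 C)) = 0 := by
      rw [e1, e2, e3] at hlamS
      linear_combination hlamS
    have p4 : cutF w C + lam * (Shat2 C - Shat1 C) = 0 := by
      have := mul_nonneg hepos.le p2
      have h5 : e * (cutF w C + lam * (Shat2 C - Shat1 C)) = 0 := by linarith
      exact (mul_eq_zero.1 h5).resolve_left hepos.ne'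
    rw [div_eq_iff hpos.ne', hShat]
    linear_combination p4
  refine ⟨⟨?_, ?_⟩, main⟩
  · -- attained: `fstar` is not constant
    have hnc : ∃ i j, fstar i < fstar j := by
      by_contra hcon
      push Not at hcon
      apply hSfs
      rcases isEmpty_or_nonempty (Fin n) with hemp | ⟨⟨a⟩⟩
      · simp [lovasz]
      · have hc : ∀ i, fstar i = fstar a := fun i => le_antisymm (hcon _ _) (hcon _ _)
        rw [lovasz_const _ hempty1 _ _ hc, lovasz_const _ hempty2 _ _ hc, huniv1, huniv2]
        simp
    obtain ⟨i, j, hij⟩ := hnc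
    have h1 : (Finset.univ.filter fun j => fstar i < fstar j).Nonempty := ⟨j, by simpa using hij⟩
    have h2 : (Finset.univ.filter fun j => fstar i < fstar j) ≠ Finset.univ := by
      intro h
      have := Finset.mem_univ i
      rw [← h] at this
      simp at this
    exact ⟨fstar i, h1, h2, (main i h1 h2).symm⟩
  · rintro r ⟨t, h1, h2, rfl⟩
    obtain ⟨a, ha⟩ : ∃ a, fstar a ≤ t := by
      by_contra hcon
      push Not at hcon
      exact h2 (by ext x; simp [hcon x])
    obtain ⟨i, hi, himax⟩ := Finset.exists_max_image
      (Finset.univ.filter fun j => fstar j ≤ t) fstar ⟨a, by simpa using ha⟩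
    have heq : (Finset.univ.filter fun j => t < fstar j) =
        (Finset.univ.filter fun j => fstar i < fstar j) := by
      ext j
      simp only [Finset.mem_filter, Finset.mem_univ, true_and] at hi himax ⊢
      constructor
      · intro h; linarith
      · intro h
        by_contra hcon
        have := himax j (not_lt.1 hcon)
        linarith
    rw [heq] at h1 h2 ⊢
    exact (main i h1 h2).ge
end

section
/- Suppose R₂ and S₁ are the Lovasz extensions of submodular set functions R̂₂, Ŝ₁ vanishing on ∅ and V (so R₂, S₁ are convex), R₁ and S₂ are convex and positively one-homogeneous, and R := R₁ − R₂ and S := S₁ − S₂ are nonnegative. Let f ∈ ℝ^V with G(f) = 1, let C* be an upper level set of f (C* = {i : f_i > t} for some t ∈ ℝ) with ∅ ≠ C* ⊊ V and S(1_{C*}) > 0, and set μ := R(1_{C*})/S(1_{C*}). Fix subgradients r₂ ∈ ∂R₂(f), s₁ ∈ ∂S₁(f) and define Φ(u) := R₁(u) − ⟨u, r₂⟩ + μ·(S₂(u) − ⟨u, s₁⟩). Then: (a) the vector 1* := 1_{C*}/G(1_{C*})^{1/p} satisfies Φ(1*) = 0; (b) every minimizer f⁺ of Φ over {u : G(u)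 ≤ 1} satisfies R(f⁺) ≤ μ·S(f⁺), and hence F(f⁺) ≤ μ whenever S(f⁺) > 0; (c) if a minimizer f⁺ has S(f⁺) > 0 and F(f⁺) = μ, then 1* is also a minimizer of Φ over {u : G(u) ≤ 1}. -/
open Finset Filter

lemma abel_zero (b D : ℕ → ℝ) (n : ℕ) (h0 : D 0 = 0) (hn : D n = 0)
    (h : ∀ k, k + 1 < n → (b (k + 1) - b k) * D (k + 1) = 0) :
    ∑ k ∈ Finset.range n, b k * (D k - D (k + 1)) = 0 := by
  have key : ∀ m, m + 1 ≤ n →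
      ∑ k ∈ Finset.range (m + 1), b k * (D k - D (k + 1)) = - b m * D (m + 1) := by
    intro m
    induction m with
    | zero => intro _; simp [h0]
    | succ m ih =>
      intro hm
      rw [Finset.sum_range_succ, ih (by omega)]
      have := h m (by omega)
      linarith
  rcases n with _ | m
  · simp
  · rw [key m le_rfl, hn]; simp

/-- Lovasz sum along a given permutation. -/
noncomputable def lovPerm {n : ℕ} (Sh : Finset (Fin n) → ℝ) (σ : Equiv.Perm (Fin n))
    (f : Fin n → ℝ) : ℝ :=
  ∑ k : Fin n, f (σ k) *
    (Sh (Finset.univ.filter fun j => (k : ℕ) ≤ (σ.symm j : ℕ)) -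
     Sh (Finset.univ.filter fun j => (k : ℕ) + 1 ≤ (σ.symm j : ℕ)))

lemma filter_level {n : ℕ} (σ : Equiv.Perm (Fin n)) (f : Fin n → ℝ) (hσ : Monotone (f ∘ σ))
    (k : ℕ) (hk : k + 1 < n)
    (hlt : f (σ ⟨k, by omega⟩) < f (σ ⟨k + 1, hk⟩)) :
    (Finset.univ.filter fun j => k + 1 ≤ (σ.symm j : ℕ)) =
      Finset.univ.filter fun j => f (σ ⟨k + 1, hk⟩) ≤ f j := by
  ext j
  simp only [Finset.mem_filter, Finset.mem_univ, true_and]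
  constructor
  · intro h
    have := hσ (show (⟨k + 1, hk⟩ : Fin n) ≤ σ.symm j from h)
    simpa using this
  · intro h
    by_contra hc
    have := hσ (show σ.symm j ≤ (⟨k, by omega⟩ : Fin n) from by
      show (σ.symm j : ℕ) ≤ k
      omega)
    simp at this
    linarith

lemma lovPerm_indep {n : ℕ} (Sh : Finset (Fin n) → ℝ) (σ τ : Equiv.Perm (Fin n))
    (f : Fin n → ℝ) (hσ : Monotone (f ∘ σ)) (hτ : Monotone (f ∘ τ)) :
    lovPerm Sh σ f = lovPerm Sh τ f := by
  have heq : f ∘ σ = f ∘ τ := by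
    rw [Tuple.comp_sort_eq_comp_iff_monotone.mpr hσ, Tuple.comp_sort_eq_comp_iff_monotone.mpr hτ]
  have heq' : ∀ k, f (σ k) = f (τ k) := fun k => congrFun heq k
  let b : ℕ → ℝ := fun k => if h : k < n then f (σ ⟨k, h⟩) else 0
  let D : ℕ → ℝ := fun k => Sh (Finset.univ.filter fun j => k ≤ (σ.symm j : ℕ)) -
    Sh (Finset.univ.filter fun j => k ≤ (τ.symm j : ℕ))
  have hz : ∑ k ∈ Finset.range n, b k * (D k - D (k + 1)) = 0 := by
    apply abel_zero
    · simp [D]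
    · have h1 : ∀ ρ : Equiv.Perm (Fin n),
          (Finset.univ.filter fun j => n ≤ (ρ.symm j : ℕ)) = ∅ := by
        intro ρ
        ext j
        simp
      simp only [D, h1, sub_self]
    · intro k hk
      have hk' : k < n := by omega
      have hle : f (σ ⟨k, hk'⟩) ≤ f (σ ⟨k + 1, hk⟩) :=
        hσ (show (⟨k, hk'⟩ : Fin n) ≤ ⟨k + 1, hk⟩ from Nat.le_succ k)
      rcases hle.eq_or_lt with h | h
      · simp [b, hk, hk', h]
      · have h2 := filter_level σ f hσ k hk h
        have h3 := filter_level τ f hτ k hk (by rw [← heq', ← heq']; exact h)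
        simp only [D]
        rw [h2, h3, heq']
        simp
  rw [Finset.sum_range] at hz
  rw [← sub_eq_zero, ← hz]
  unfold lovPerm
  rw [← Finset.sum_sub_distrib]
  refine Finset.sum_congr rfl fun k _ => ?_
  simp only [b, D, k.isLt, dite_true, Fin.eta, ← heq' k]
  ring

lemma lovasz_eq {n : ℕ} (Sh : Finset (Fin n) → ℝ) (σ : Equiv.Perm (Fin n))
    (f : Fin n → ℝ) (hσ : Monotone (f ∘ σ)) : lovasz Sh f = lovPerm Sh σ f :=
  lovPerm_indep Sh (Tuple.sort f) σ f (Tuple.monotone_sort f) hσ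

lemma lovPerm_add {n : ℕ} (Sh : Finset (Fin n) → ℝ) (σ : Equiv.Perm (Fin n))
    (f g : Fin n → ℝ) (c : ℝ) :
    lovPerm Sh σ (f + c • g) = lovPerm Sh σ f + c * lovPerm Sh σ g := by
  unfold lovPerm
  rw [Finset.mul_sum, ← Finset.sum_add_distrib]
  refine Finset.sum_congr rfl fun k _ => ?_
  simp only [Pi.add_apply, Pi.smul_apply, smul_eq_mul]
  ring

lemma lovasz_hom {n : ℕ} (Sh : Finset (Fin n) → ℝ) (f : Fin n → ℝ) (c : ℝ) (hc : 0 ≤ c) :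
    lovasz Sh (c • f) = c * lovasz Sh f := by
  have hm := Tuple.monotone_sort f
  rw [lovasz_eq Sh (Tuple.sort f) (c • f), lovasz_eq Sh (Tuple.sort f) f hm]
  · unfold lovPerm
    rw [Finset.mul_sum]
    refine Finset.sum_congr rfl fun k _ => ?_
    simp only [Pi.smul_apply, smul_eq_mul]
    ring
  · intro i j hij
    exact mul_le_mul_of_nonneg_left (hm hij) hc

lemma ip_smul {V : Type*} [Fintype V] (c : ℝ) (f g : V → ℝ) : ip (c • f) g = c * ip f g := by
  simp [ip, Finset.mul_sum, mul_assoc]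

lemma ip_comm' {V : Type*} [Fintype V] (f g : V → ℝ) : ip f g = ip g f := by
  simp [ip, mul_comm]

lemma ip_sub'_s19 {V : Type*} [Fintype V] (f g h : V → ℝ) : ip f (g - h) = ip f g - ip f h := by
  simp [ip, mul_sub]

lemma sub_le {n : ℕ} (Sh : Finset (Fin n) → ℝ) (f a u : Fin n → ℝ)
    (ha : a ∈ subdiff (lovasz Sh) f) : ip u a ≤ lovasz Sh u := by
  have ha' : ∀ v, lovasz Sh f + ip a (v - f) ≤ lovasz Sh v := ha
  -- Euler identity
  have h2 := ha' ((2 : ℝ) • f)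
  have h0 := ha' ((0 : ℝ) • f)
  rw [lovasz_hom _ _ _ (by norm_num), ip_sub'_s19, ip_comm' a, ip_smul] at h2 h0
  have hu := ha' u
  rw [ip_sub'_s19] at hu
  rw [ip_comm' u a]
  rw [ip_comm' f a] at h2 h0
  linarith

lemma sub_eq {n : ℕ} (Sh : Finset (Fin n) → ℝ) (f a : Fin n → ℝ) (t : ℝ) (C : Finset (Fin n))
    (hC : C = Finset.univ.filter fun i => t < f i) (hne : C.Nonempty)
    (ha : a ∈ subdiff (lovasz Sh) f) : ip (indic C) a = lovasz Sh (indic C) := by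
  apply le_antisymm (sub_le Sh f a _ ha)
  have hmem : ∀ i, i ∈ C ↔ t < f i := by intro i; simp [hC]
  obtain ⟨i0, hi0, hmin⟩ := C.exists_min_image f hne
  have he : 0 < f i0 - t := by linarith [(hmem i0).1 hi0]
  have hm := Tuple.monotone_sort f
  have h1 : Monotone (indic C ∘ Tuple.sort f) := by
    intro i j hij
    have h := hm hij
    simp only [Function.comp_apply, indic, hmem] at h ⊢
    split_ifs <;> linarith
  have h2 : Monotone ((f + (-(f i0 - t)) • indic C) ∘ Tuple.sort f) := by
    intro i j hij
    have h := hm hij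
    have hj := hmin (Tuple.sort f j)
    simp only [Function.comp_apply, indic, hmem, Pi.add_apply, Pi.smul_apply, smul_eq_mul]
      at h hj ⊢
    split_ifs with h3 h4 h4
    · linarith
    · linarith
    · linarith [hj h4]
    · linarith
  have ha' := (show ∀ v, lovasz Sh f + ip a (v - f) ≤ lovasz Sh v from ha)
    (f + (-(f i0 - t)) • indic C)
  rw [lovasz_eq Sh _ _ h2, lovPerm_add, lovasz_eq Sh _ _ hm, add_sub_cancel_left, ip_comm',
    ip_smul] at ha'
  rw [lovasz_eq Sh _ _ h1]
  have : (f i0 - t) * lovPerm Sh (Tuple.sort f) (indic C) ≤ (f i0 - t) * ip (indic C) a := by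
    linarith
  exact le_of_mul_le_mul_left this he

/-- key descent inequality behind finite termination: with `R₂, S₁`
Lovasz extensions of submodular set functions, `C*` an upper level set of `f` and
`μ = R(1_{C*})/S(1_{C*})`: (a) the normalized indicator `1*` has `Φ(1*) = 0`;
(b) every minimizer `f⁺` of `Φ` over `{G ≤ 1}` satisfies `R(f⁺) ≤ μ·S(f⁺)`, hence
`F(f⁺) ≤ μ` if `S(f⁺) > 0`; (c) if a minimizer has `S(f⁺) > 0` and `F(f⁺) = μ`, then
`1*` is also a minimizer. -/
theorem ratioDCA_prox_optimal_thresholding_descent {n : ℕ} (p : ℝ) (hp : 1 ≤ p)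
    (R1 S2 G : (Fin n → ℝ) → ℝ)
    (Rhat2 Shat1 : Finset (Fin n) → ℝ)
    (hsubR2 : ∀ A B : Finset (Fin n), Rhat2 (A ∪ B) + Rhat2 (A ∩ B) ≤ Rhat2 A + Rhat2 B)
    (hsubS1 : ∀ A B : Finset (Fin n), Shat1 (A ∪ B) + Shat1 (A ∩ B) ≤ Shat1 A + Shat1 B)
    (hemptyR2 : Rhat2 ∅ = 0) (hunivR2 : Rhat2 Finset.univ = 0)
    (hemptyS1 : Shat1 ∅ = 0) (hunivS1 : Shat1 Finset.univ = 0)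
    (hR1conv : ConvexOn ℝ Set.univ R1) (hS2conv : ConvexOn ℝ Set.univ S2)
    (hR1hom : PosOneHom R1) (hS2hom : PosOneHom S2)
    (hRnonneg : ∀ u, 0 ≤ R1 u - lovasz Rhat2 u)
    (hSnonneg : ∀ u, 0 ≤ lovasz Shat1 u - S2 u)
    (hGconv : ConvexOn ℝ Set.univ G) (hGnonneg : ∀ u, 0 ≤ G u)
    (hGhom : PosPHom p G) (hGzero : ∀ u, G u = 0 ↔ u = 0)
    (f : Fin n → ℝ) (hGf : G f = 1)
    (t : ℝ) (Cs : Finset (Fin n)) (hCs : Cs = Finset.univ.filter fun i => t < f i)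
    (hCne : Cs.Nonempty) (hCproper : Cs ≠ Finset.univ)
    (hSC : 0 < lovasz Shat1 (indic Cs) - S2 (indic Cs))
    (μ : ℝ)
    (hμ : μ = (R1 (indic Cs) - lovasz Rhat2 (indic Cs)) /
      (lovasz Shat1 (indic Cs) - S2 (indic Cs)))
    (r2 : Fin n → ℝ) (hr2 : r2 ∈ subdiff (lovasz Rhat2) f)
    (s1 : Fin n → ℝ) (hs1 : s1 ∈ subdiff (lovasz Shat1) f)
    (ones : Fin n → ℝ) (hones : ones = (G (indic Cs) ^ ((1 : ℝ) / p))⁻¹ • indic Cs) :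
    (R1 ones - ip ones r2 + μ * (S2 ones - ip ones s1) = 0) ∧
    (∀ fplus : Fin n → ℝ, G fplus ≤ 1 →
      (∀ u, G u ≤ 1 →
        R1 fplus - ip fplus r2 + μ * (S2 fplus - ip fplus s1) ≤
          R1 u - ip u r2 + μ * (S2 u - ip u s1)) →
      (R1 fplus - lovasz Rhat2 fplus ≤ μ * (lovasz Shat1 fplus - S2 fplus) ∧
        (0 < lovasz Shat1 fplus - S2 fplus →
          (R1 fplus - lovasz Rhat2 fplus) / (lovasz Shat1 fplus - S2 fplus) ≤ μ))) ∧
    (∀ fplus : Fin n → ℝ, G fplus ≤ 1 →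
      (∀ u, G u ≤ 1 →
        R1 fplus - ip fplus r2 + μ * (S2 fplus - ip fplus s1) ≤
          R1 u - ip u r2 + μ * (S2 u - ip u s1)) →
      0 < lovasz Shat1 fplus - S2 fplus →
      (R1 fplus - lovasz Rhat2 fplus) / (lovasz Shat1 fplus - S2 fplus) = μ →
      (G ones ≤ 1 ∧ ∀ u, G u ≤ 1 →
        R1 ones - ip ones r2 + μ * (S2 ones - ip ones s1) ≤
          R1 u - ip u r2 + μ * (S2 u - ip u s1))) := by
  have eR := sub_eq Rhat2 f r2 t Cs hCs hCne hr2
  have eS := sub_eq Shat1 f s1 t Cs hCs hCne hs1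
  have hμ0 : 0 ≤ μ := by rw [hμ]; exact div_nonneg (hRnonneg _) hSC.le
  have hμ' : μ * (lovasz Shat1 (indic Cs) - S2 (indic Cs)) =
      R1 (indic Cs) - lovasz Rhat2 (indic Cs) := by
    rw [hμ]; exact div_mul_cancel₀ _ hSC.ne'
  have hpos : 0 ≤ (G (indic Cs) ^ ((1 : ℝ) / p))⁻¹ :=
    inv_nonneg.2 (Real.rpow_nonneg (hGnonneg _) _)
  have hA : R1 ones - ip ones r2 + μ * (S2 ones - ip ones s1) = 0 := by
    rw [hones, hR1hom _ hpos, hS2hom _ hpos, ip_smul, ip_smul, eR, eS]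
    linear_combination -(G (indic Cs) ^ ((1 : ℝ) / p))⁻¹ * hμ'
  have hGC : G (indic Cs) ≠ 0 := by
    intro h
    obtain ⟨i, hi⟩ := hCne
    have := congrFun ((hGzero _).1 h) i
    simp [indic, hi] at this
  have hG1 : G ones ≤ 1 := by
    rw [hones, hGhom _ hpos, Real.inv_rpow (Real.rpow_nonneg (hGnonneg _) _),
      ← Real.rpow_mul (hGnonneg _), one_div, inv_mul_cancel₀ (by linarith), Real.rpow_one,
      inv_mul_cancel₀ hGC]
  have hlow : ∀ u, R1 u - lovasz Rhat2 u - μ * (lovasz Shat1 u - S2 u) ≤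
      R1 u - ip u r2 + μ * (S2 u - ip u s1) := by
    intro u
    have h1 := sub_le Rhat2 f r2 u hr2
    have h2 := mul_le_mul_of_nonneg_left (sub_le Shat1 f s1 u hs1) hμ0
    linarith
  refine ⟨hA, ?_, ?_⟩
  · intro fp _ hmin
    have h1 := hmin ones hG1
    rw [hA] at h1
    have h2 := hlow fp
    have h3 : R1 fp - lovasz Rhat2 fp ≤ μ * (lovasz Shat1 fp - S2 fp) := by linarith
    exact ⟨h3, fun hS => (div_le_iff₀ hS).2 h3⟩
  · intro fp _ hmin hS hF
    refine ⟨hG1, fun u hu => ?_⟩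
    rw [hA]
    have h1 := hmin u hu
    have h2 := hlow fp
    rw [div_eq_iff hS.ne'] at hF
    linarith
end
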